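/- A sequence ω ∈ {a,b}^ℤ belongs to Σ_ξ for every ordering ξ of the Pascal graph if and only if ω is one of the following: the constant sequence a^∞, the constant sequence b^∞, a sequence equal to b at exactly one coordinate and to a elsewhere (a shift of a^∞.ba^∞), or a sequence equal to a at exactly one coordinate and to b elsewhere (a shift of b^∞.ab^∞). In other words, the small subshift ∩_ξ Σ_ξ consists of exactly the two fixed points of the shift and the orbits of a^∞.ba^∞ and b^∞.ab^∞. -/

import Mathlib

/-- Vertex reached after `n` moves: (number of `false` moves, number of `true` moves). -/
def vertexAt (γ : ℕ → Bool) (n : ℕ) : ℕ × ℕ :=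
  (((Finset.range n).filter fun i => γ i = false).card,
   ((Finset.range n).filter fun i => γ i = true).card)

def childOf (v : ℕ × ℕ) (m : Bool) : ℕ × ℕ :=
  if m then (v.1, v.2 + 1) else (v.1 + 1, v.2)

def MoveMin (ξ : ℕ × ℕ → Bool) (v : ℕ × ℕ) (m : Bool) : Prop :=
  (childOf v m).1 = 0 ∨ (childOf v m).2 = 0 ∨ m = !ξ (childOf v m)

def MoveMax (ξ : ℕ × ℕ → Bool) (v : ℕ × ℕ) (m : Bool) : Prop :=
  (childOf v m).1 = 0 ∨ (childOf v m).2 = 0 ∨ m = ξ (childOf v m)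

def IsMinEdge (ξ : ℕ × ℕ → Bool) (γ : ℕ → Bool) (i : ℕ) : Prop :=
  MoveMin ξ (vertexAt γ i) (γ i)

def IsMaxEdge (ξ : ℕ × ℕ → Bool) (γ : ℕ → Bool) (i : ℕ) : Prop :=
  MoveMax ξ (vertexAt γ i) (γ i)

def XMin (ξ : ℕ × ℕ → Bool) : Set (ℕ → Bool) := {γ | ∀ i, IsMinEdge ξ γ i}

def XMax (ξ : ℕ × ℕ → Bool) : Set (ℕ → Bool) := {γ | ∀ i, IsMaxEdge ξ γ i}

def XPrime (ξ : ℕ × ℕ → Bool) : Set (ℕ → Bool) :=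
  {γ | ∃ δ ∈ XMin ξ ∪ XMax ξ, ∃ N : ℕ, ∀ n, N ≤ n → γ n = δ n}

/-- The all-ξ-minimal finite path (list of moves) from the root to a vertex. -/
def minPath (ξ : ℕ × ℕ → Bool) : ℕ × ℕ → List Bool
  | (0, 0) => []
  | (x + 1, 0) => minPath ξ (x, 0) ++ [false]
  | (0, y + 1) => minPath ξ (0, y) ++ [true]
  | (x + 1, y + 1) =>
      if ξ (x + 1, y + 1) then minPath ξ (x, y + 1) ++ [false]
      else minPath ξ (x + 1, y) ++ [true]
  termination_by p => p.1 + p.2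

/-- The all-ξ-maximal finite path (list of moves) from the root to a vertex. -/
def maxPath (ξ : ℕ × ℕ → Bool) : ℕ × ℕ → List Bool
  | (0, 0) => []
  | (x + 1, 0) => maxPath ξ (x, 0) ++ [false]
  | (0, y + 1) => maxPath ξ (0, y) ++ [true]
  | (x + 1, y + 1) =>
      if ξ (x + 1, y + 1) then maxPath ξ (x + 1, y) ++ [true]
      else maxPath ξ (x, y + 1) ++ [false]
  termination_by p => p.1 + p.2

open Classical in
/-- The adic (Vershik) transformation determined by ξ (identity where undefined). -/
noncomputable def adicT (ξ : ℕ × ℕ → Bool) (γ : ℕ → Bool) : ℕ → Bool :=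
  if h : ∃ i, ¬ IsMaxEdge ξ γ i then
    let i0 := Nat.find h
    let v := vertexAt γ (i0 + 1)
    let src : ℕ × ℕ := if ξ v then (v.1, v.2 - 1) else (v.1 - 1, v.2)
    fun n =>
      if n < i0 then (minPath ξ src).getD n false
      else if n = i0 then ξ v
      else γ n
  else γ

open Classical in
/-- The inverse adic transformation determined by ξ (identity where undefined). -/
noncomputable def adicTInv (ξ : ℕ × ℕ → Bool) (γ : ℕ → Bool) : ℕ → Bool :=
  if h : ∃ i, ¬ IsMinEdge ξ γ i then
    let i0 := Nat.find h
    let v := vertexAt γ (i0 + 1)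
    let src : ℕ × ℕ := if ξ v then (v.1 - 1, v.2) else (v.1, v.2 - 1)
    fun n =>
      if n < i0 then (maxPath ξ src).getD n false
      else if n = i0 then !ξ v
      else γ n
  else γ

/-- ℤ-iterates of the adic transformation. -/
noncomputable def adicIter (ξ : ℕ × ℕ → Bool) : ℤ → (ℕ → Bool) → (ℕ → Bool)
  | Int.ofNat n, γ => (adicT ξ)^[n] γ
  | Int.negSucc n, γ => (adicTInv ξ)^[n + 1] γ

/-- The k-coding of the orbit of γ: symbols are the initial segments of length k. -/
noncomputable def omegaCode (ξ : ℕ × ℕ → Bool) (k : ℕ) (γ : ℕ → Bool) : ℤ → List Bool :=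
  fun t => (List.range k).map (adicIter ξ t γ)

/-- Ordered list of all initial segments from the root to (x,y), in increasing ξ-order. -/
def segList (ξ : ℕ × ℕ → Bool) : ℕ × ℕ → List (List Bool)
  | (0, 0) => [[]]
  | (x + 1, 0) => (segList ξ (x, 0)).map (· ++ [false])
  | (0, y + 1) => (segList ξ (0, y)).map (· ++ [true])
  | (x + 1, y + 1) =>
      if ξ (x + 1, y + 1) then
        (segList ξ (x, y + 1)).map (· ++ [false]) ++ (segList ξ (x + 1, y)).map (· ++ [true])
      else
        (segList ξ (x + 1, y)).map (· ++ [true]) ++ (segList ξ (x, y + 1)).map (· ++ [false])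
  termination_by p => p.1 + p.2

/-- Level-k coded basic block at a vertex (x,y) with x+y ≥ k, a word over the
alphabet of initial segments of length k. -/
def codedBlock (ξ : ℕ × ℕ → Bool) (k : ℕ) : ℕ × ℕ → List (List Bool)
  | (0, 0) => segList ξ (0, 0)
  | (x + 1, 0) => if x + 1 ≤ k then segList ξ (x + 1, 0) else [List.replicate k false]
  | (0, y + 1) => if y + 1 ≤ k then segList ξ (0, y + 1) else [List.replicate k true]
  | (x + 1, y + 1) =>
      if x + 1 + (y + 1) ≤ k then segList ξ (x + 1, y + 1)
      else if ξ (x + 1, y + 1) then codedBlock ξ k (x, y + 1) ++ codedBlock ξ k (x + 1, y)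
      else codedBlock ξ k (x + 1, y) ++ codedBlock ξ k (x, y + 1)
  termination_by p => p.1 + p.2

/-- Basic block over the alphabet {a,b}, with a = `false` and b = `true`. -/
def basicBlock (ξ : ℕ × ℕ → Bool) : ℕ × ℕ → List Bool
  | (0, 0) => []
  | (_ + 1, 0) => [false]
  | (0, _ + 1) => [true]
  | (x + 1, y + 1) =>
      if ξ (x + 1, y + 1) then basicBlock ξ (x, y + 1) ++ basicBlock ξ (x + 1, y)
      else basicBlock ξ (x + 1, y) ++ basicBlock ξ (x, y + 1)
  termination_by p => p.1 + p.2

/-- The finite word ω_s ω_{s+1} ... ω_{t-1}. -/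
def wordAt (ω : ℤ → List Bool) (s t : ℤ) : List (List Bool) :=
  (List.range (t - s).toNat).map fun u => ω (s + u)

/-- A ξ-consistent factoring scheme for ω ∈ 𝒫_k^ℤ: `cuts j` is the set of starting
positions of the blocks of the level-(k+j) factorization, and `vert j s` is the
vertex whose coded basic block is the block starting at the cut `s`. -/
def IsConsistentScheme (ξ : ℕ × ℕ → Bool) (k : ℕ) (ω : ℤ → List Bool)
    (cuts : ℕ → Set ℤ) (vert : ℕ → ℤ → ℕ × ℕ) : Prop :=
  (∀ j : ℕ, ∀ M : ℤ, ∃ s ∈ cuts j, s < M) ∧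
  (∀ j : ℕ, ∀ M : ℤ, ∃ t ∈ cuts j, M < t) ∧
  (∀ j : ℕ, ∀ s ∈ cuts j, ∀ t ∈ cuts j, s < t → (∀ u ∈ cuts j, ¬(s < u ∧ u < t)) →
      (vert j s).1 + (vert j s).2 = k + j ∧
      wordAt ω s t = codedBlock ξ k (vert j s)) ∧
  (∀ j : ℕ, cuts (j + 1) ⊆ cuts j) ∧
  (∀ j : ℕ, ∀ s ∈ cuts (j + 1), ∀ t ∈ cuts (j + 1), s < t →
      (∀ u ∈ cuts (j + 1), ¬(s < u ∧ u < t)) →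
      ∀ x y : ℕ, vert (j + 1) s = (x + 1, y + 1) →
        ∃ m ∈ cuts j, s < m ∧ m < t ∧ (∀ u ∈ cuts j, s < u → u < t → u = m) ∧
          (if ξ (x + 1, y + 1)
            then vert j s = (x, y + 1) ∧ vert j m = (x + 1, y)
            else vert j s = (x + 1, y) ∧ vert j m = (x, y + 1)))

/-- The natural factoring scheme of the k-coding of γ: a level-(k+j) block begins at
coordinate t exactly when T^t γ begins with an all-ξ-minimal path to its level-(k+j) vertex. -/
noncomputable def natCuts (ξ : ℕ × ℕ → Bool) (k : ℕ) (γ : ℕ → Bool) : ℕ → Set ℤ :=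
  fun j => {t | ∀ i < k + j, IsMinEdge ξ (adicIter ξ t γ) i}

noncomputable def natVert (ξ : ℕ × ℕ → Bool) (k : ℕ) (γ : ℕ → Bool) : ℕ → ℤ → ℕ × ℕ :=
  fun j t => vertexAt (adicIter ξ t γ) (k + j)

open Classical in
/-- The return time r_n of the Kink Lemma, where `g` is the move of γ leaving (i,j). -/
noncomputable def kinkReturn (ξ : ℕ × ℕ → Bool) (i j : ℕ) (g : Bool) : ℕ :=
  let n := i + j
  if MoveMax ξ (i, j) g ∧ MoveMin ξ (i, j) (!g) then n.choose j
  else if (MoveMin ξ (i, j) g ∧ MoveMin ξ (i, j) (!g) ∧ g = true) ∨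
          (MoveMax ξ (i, j) g ∧ MoveMax ξ (i, j) (!g) ∧ g = false) then (n + 1).choose (j + 1)
  else if (MoveMin ξ (i, j) g ∧ MoveMin ξ (i, j) (!g) ∧ g = false) ∨
          (MoveMax ξ (i, j) g ∧ MoveMax ξ (i, j) (!g) ∧ g = true) then (n + 1).choose j
  else (n + 1).choose j + n.choose (j + 1)

/-- Convert a length-k list of moves to a function `Fin k → Bool`. -/
def segFn (k : ℕ) (w : List Bool) : Fin k → Bool := fun idx => w.getD idx false

/-- The subshift Σ_k of the k-codings: sequences all of whose finite subblocks occur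
in some level-k coded basic block. -/
def SigmaK (ξ : ℕ × ℕ → Bool) (k : ℕ) : Set (ℤ → (Fin k → Bool)) :=
  {ω | ∀ (s : ℤ) (l : ℕ), ∃ p : ℕ × ℕ,
    ((List.range l).map fun u => ω (s + u)) <:+: (codedBlock ξ k p).map (segFn k)}

/-- The subshift Σ_ξ ⊆ {a,b}^ℤ of sequences all of whose finite subblocks occur in
some basic block B_ξ(x,y). -/
def SigmaXi (ξ : ℕ × ℕ → Bool) : Set (ℤ → Bool) :=
  {ω | ∀ (s : ℤ) (l : ℕ), ∃ p : ℕ × ℕ,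
    ((List.range l).map fun u => ω (s + u)) <:+: basicBlock ξ p}

/-- The big subshift Σ: sequences all of whose finite subblocks occur in some basic
block B_ξ(x,y) for some ordering ξ. -/
def BigShift : Set (ℤ → Bool) :=
  {ω | ∀ (s : ℤ) (l : ℕ), ∃ (ξ : ℕ × ℕ → Bool) (p : ℕ × ℕ),
    ((List.range l).map fun u => ω (s + u)) <:+: basicBlock ξ p}

/-! ### Basic blocks: recursion and symmetries -/

theorem basicBlock_succ_succ (ξ : ℕ × ℕ → Bool) (x y : ℕ) :
    basicBlock ξ (x + 1, y + 1) =
      if ξ (x + 1, y + 1) then basicBlock ξ (x, y + 1) ++ basicBlock ξ (x + 1, y)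
      else basicBlock ξ (x + 1, y) ++ basicBlock ξ (x, y + 1) := by
  rw [basicBlock]

@[simp] theorem basicBlock_succ_zero (ξ : ℕ × ℕ → Bool) (x : ℕ) :
    basicBlock ξ (x + 1, 0) = [false] := by
  rw [basicBlock]

@[simp] theorem basicBlock_zero_succ (ξ : ℕ × ℕ → Bool) (y : ℕ) :
    basicBlock ξ (0, y + 1) = [true] := by
  rw [basicBlock]

@[simp] theorem basicBlock_zero_zero (ξ : ℕ × ℕ → Bool) : basicBlock ξ (0, 0) = [] := by
  rw [basicBlock]

/-- A property of words that passes to `[]`, to boundary blocks and to interior blocks from their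
two predecessors holds for all basic blocks. -/
theorem basicBlock_vertex_induction {P : ℕ → ℕ → Prop} (h00 : P 0 0)
    (hx : ∀ x, P (x + 1) 0) (hy : ∀ y, P 0 (y + 1))
    (hxy : ∀ x y, P x (y + 1) → P (x + 1) y → P (x + 1) (y + 1)) (x y : ℕ) : P x y := by
  induction y generalizing x with
  | zero => cases x with
    | zero => exact h00
    | succ x => exact hx x
  | succ y ihy => induction x with
    | zero => exact hy y
    | succ x ihx => exact hxy x y ihx (ihy (x + 1))

theorem basicBlock_not (ξ : ℕ × ℕ → Bool) (x y : ℕ) :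
    basicBlock (fun p => !ξ p) (x, y) = (basicBlock ξ (x, y)).reverse := by
  induction x, y using basicBlock_vertex_induction with
  | h00 => simp
  | hx x => simp
  | hy y => simp
  | hxy x y h₁ h₂ =>
    rw [basicBlock_succ_succ, basicBlock_succ_succ, h₁, h₂]
    cases ξ (x + 1, y + 1) <;> simp

theorem basicBlock_not_swap (ξ : ℕ × ℕ → Bool) (x y : ℕ) :
    basicBlock (fun p => !ξ p.swap) (x, y) = (basicBlock ξ (y, x)).map not := by
  induction x, y using basicBlock_vertex_induction with
  | h00 => simp
  | hx x => simp
  | hy y => simp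
  | hxy x y h₁ h₂ =>
    rw [basicBlock_succ_succ, basicBlock_succ_succ, h₁, h₂]
    cases h : ξ (y + 1, x + 1) <;> simp [h]

/-- The word `w` occurs in no basic block of some ordering. -/
def Avoidable (w : List Bool) : Prop :=
  ∃ ξ : ℕ × ℕ → Bool, ∀ x y, ¬ w <:+: basicBlock ξ (x, y)

theorem Avoidable.reverse {w : List Bool} (h : Avoidable w) : Avoidable w.reverse := by
  obtain ⟨ξ, h⟩ := h
  refine ⟨fun p => !ξ p, fun x y hw => h x y ?_⟩
  rwa [basicBlock_not, List.reverse_infix] at hw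

theorem Avoidable.map_not {w : List Bool} (h : Avoidable w) : Avoidable (w.map not) := by
  obtain ⟨ξ, h⟩ := h
  refine ⟨fun p => !ξ p.swap, fun x y hw => h y x ?_⟩
  rw [basicBlock_not_swap] at hw
  simpa [Function.comp_def] using hw.map not

/-! ### The constant ordering `1` -/

/-- The ordering with constant value `1`. -/
def constOrd : ℕ × ℕ → Bool := fun _ => true

theorem constOrd_block (x y : ℕ) : basicBlock constOrd (x + 1, y + 1) =
    basicBlock constOrd (x, y + 1) ++ basicBlock constOrd (x + 1, y) := by
  rw [basicBlock_succ_succ]; rfl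

theorem constOrd_count_true (x : ℕ) : (basicBlock constOrd (x, 1)).count true = 1 := by
  induction x with
  | zero => simp
  | succ x ih => rw [constOrd_block]; simp [ih]

theorem constOrd_count_false (y : ℕ) : (basicBlock constOrd (1, y)).count false = 1 := by
  induction y with
  | zero => simp
  | succ y ih => rw [constOrd_block]; simp [ih]

theorem constOrd_head (x y : ℕ) : [true] <+: basicBlock constOrd (x, y + 1) := by
  induction x with
  | zero => simp
  | succ x ih => rw [constOrd_block]; exact ih.trans (List.prefix_append _ _)

theorem constOrd_head_two (x y : ℕ) : [true, true] <+: basicBlock constOrd (x + 1, y + 2) := by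
  induction x with
  | zero =>
    rw [constOrd_block]
    simpa using constOrd_head 1 y
  | succ x ih => rw [constOrd_block]; exact ih.trans (List.prefix_append _ _)

theorem constOrd_last (x y : ℕ) : [false] <:+ basicBlock constOrd (x + 1, y) := by
  induction y with
  | zero => simp
  | succ y ih => rw [constOrd_block]; exact ih.trans (List.suffix_append _ _)

theorem constOrd_last_two (x y : ℕ) : [false, false] <:+ basicBlock constOrd (x + 2, y + 1) := by
  induction y with
  | zero =>
    rw [constOrd_block]
    obtain ⟨l, hl⟩ := constOrd_last x 1
    exact ⟨l, by simp [← hl]⟩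
  | succ y ih => rw [constOrd_block]; exact ih.trans (List.suffix_append _ _)

theorem not_prefix_of_ne {b c : Bool} {w v : List Bool} (h : [b] <+: v) (hbc : c ≠ b) :
    ¬ (c :: w) <+: v := by
  rintro ⟨r, rfl⟩
  simp_all

theorem not_suffix_of_ne {b c : Bool} {w v : List Bool} (h : [b] <:+ v) (hbc : c ≠ b) :
    ¬ (w ++ [c]) <:+ v := by
  intro hw
  rw [← List.reverse_prefix] at h hw
  simp only [List.reverse_append, List.reverse_cons, List.reverse_nil, List.nil_append,
    List.singleton_append] at h hw
  exact not_prefix_of_ne h hbc hw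

theorem avoidable_ttff : Avoidable [true, true, false, false] := by
  refine ⟨constOrd, fun x y => ?_⟩
  induction x, y using basicBlock_vertex_induction with
  | h00 => simp
  | hx x => intro h; simpa using h.length_le
  | hy y => intro h; simpa using h.length_le
  | hxy x y h₁ h₂ =>
    rw [constOrd_block, List.infix_append_iff_ne_nil]
    rintro (h | h | ⟨l, r, hl, hr, hlr, hsl, hsr⟩)
    · exact h₁ h
    · exact h₂ h
    have hcase : (l = [true] ∧ r = [true, false, false]) ∨
        (l = [true, true] ∧ r = [false, false]) ∨ (l = [true, true, false] ∧ r = [false]) := by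
      rcases l with _ | ⟨a, _ | ⟨b, _ | ⟨c, _ | ⟨d, l⟩⟩⟩⟩ <;> simp_all
    rcases hcase with ⟨rfl, rfl⟩ | ⟨rfl, rfl⟩ | ⟨rfl, rfl⟩
    · cases x with
      | zero =>
        have := hsr.sublist.count_le false
        rw [zero_add, constOrd_count_false] at this
        simp at this
      | succ x => exact not_suffix_of_ne (w := []) (constOrd_last x (y + 1)) (by simp) hsl
    · cases x with
      | zero => simpa using hsl.length_le
      | succ x => exact not_suffix_of_ne (w := [true]) (constOrd_last x (y + 1)) (by simp) hsl
    · cases y with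
      | zero =>
        have := hsl.sublist.count_le true
        rw [zero_add, constOrd_count_true] at this
        simp at this
      | succ y => exact not_prefix_of_ne (constOrd_head (x + 1) y) (by simp) hsr

theorem avoidable_ftft : Avoidable [false, true, false, true] := by
  refine ⟨constOrd, fun x y => ?_⟩
  induction x, y using basicBlock_vertex_induction with
  | h00 => simp
  | hx x => intro h; simpa using h.length_le
  | hy y => intro h; simpa using h.length_le
  | hxy x y h₁ h₂ =>
    rw [constOrd_block, List.infix_append_iff_ne_nil]
    rintro (h | h | ⟨l, r, hl, hr, hlr, hsl, hsr⟩)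
    · exact h₁ h
    · exact h₂ h
    have hcase : (l = [false] ∧ r = [true, false, true]) ∨
        (l = [false, true] ∧ r = [false, true]) ∨ (l = [false, true, false] ∧ r = [true]) := by
      rcases l with _ | ⟨a, _ | ⟨b, _ | ⟨c, _ | ⟨d, l⟩⟩⟩⟩ <;> simp_all
    rcases hcase with ⟨rfl, rfl⟩ | ⟨rfl, rfl⟩ | ⟨rfl, rfl⟩
    · rcases y with _ | _ | y
      · simpa using hsr.length_le
      · have := hsr.sublist.count_le true
        rw [zero_add, constOrd_count_true] at this
        simp at this
      · obtain ⟨s, hs⟩ := constOrd_head_two x y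
        rw [← hs] at hsr
        simp at hsr
    · cases x with
      | zero => simpa using hsl.length_le
      | succ x => exact not_suffix_of_ne (w := [false]) (constOrd_last x (y + 1)) (by simp) hsl
    · rcases x with _ | _ | x
      · simpa using hsl.length_le
      · have := hsl.sublist.count_le false
        rw [zero_add, constOrd_count_false] at this
        simp at this
      · obtain ⟨s, hs⟩ := constOrd_last_two x y
        rw [← hs, ← List.reverse_prefix] at hsl
        simp at hsl

/-! ### Avoiding a long gap between two occurrences of `true` -/

theorem lead_unique {i j : ℕ} {v : List Bool} (hi : List.replicate i false ++ [true] <+: v)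
    (hj : List.replicate j false ++ [true] <+: v) : i = j := by
  induction i generalizing j v with
  | zero => cases j with
    | zero => rfl
    | succ j => exact absurd hj (not_prefix_of_ne (by simpa using hi) (by simp))
  | succ i ih => cases j with
    | zero => exact absurd hi (not_prefix_of_ne (by simpa using hj) (by simp))
    | succ j =>
      obtain ⟨s, rfl⟩ := hi
      simp only [List.replicate_succ, List.cons_append, List.cons_prefix_cons, true_and] at hj
      rw [ih (List.prefix_append _ s) (by simpa using hj)]

theorem trail_unique {i j : ℕ} {u : List Bool} (hi : true :: List.replicate i false <:+ u)
    (hj : true :: List.replicate j false <:+ u) : i = j := by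
  rw [← List.reverse_prefix] at hi hj
  simp only [List.reverse_cons, List.reverse_replicate] at hi hj
  exact lead_unique hi hj

/-- The word `b aⁿ b`. -/
def gapWord (n : ℕ) : List Bool := true :: (List.replicate n false ++ [true])

theorem not_gapWord_infix_append {n i j : ℕ} {u v : List Bool} (hu : ¬ gapWord n <:+: u)
    (hv : ¬ gapWord n <:+: v) (hj : true :: List.replicate j false <:+ u)
    (hi : List.replicate i false ++ [true] <+: v) (hij : i + j ≠ n) :
    ¬ gapWord n <:+: u ++ v := by
  rw [List.infix_append_iff_ne_nil]
  rintro (h | h | ⟨l, r, hl, hr, hlr, hsl, hsr⟩)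
  · exact hu h
  · exact hv h
  obtain ⟨a, l, rfl⟩ := List.exists_cons_of_ne_nil hl
  simp only [gapWord, List.cons_append, List.cons.injEq] at hlr
  obtain ⟨rfl, hlr⟩ := hlr
  have key : ∃ k m, k + m = n ∧ l = List.replicate k false ∧
      r = List.replicate m false ++ [true] := by
    rcases List.append_eq_append_iff.1 hlr with ⟨s, hs, hs'⟩ | ⟨s, hs, hs'⟩
    · obtain ⟨rfl, rfl⟩ : s = [] ∧ r = [true] := by
        cases s <;> simp_all
      exact ⟨n, 0, rfl, by simpa using hs, by simp⟩
    · obtain ⟨h₁, h₂, h₃⟩ := List.append_eq_replicate_iff.1 hs.symm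
      exact ⟨l.length, s.length, h₁, h₂, by rw [hs', ← h₃]⟩
  obtain ⟨k, m, hkm, rfl, rfl⟩ := key
  have := trail_unique hj hsl
  have := lead_unique hi hsr
  omega

/-- An ordering none of whose basic blocks contains `b aⁿ b`, if `n ≥ 2`. -/
def gapOrd (n : ℕ) : ℕ × ℕ → Bool := fun p => decide (p.2 ≠ 2 ∧ p ≠ (n, 1))

theorem gapOrd_row_one_lt {n x : ℕ} (hx : x < n) :
    basicBlock (gapOrd n) (x, 1) = true :: List.replicate x false := by
  induction x with
  | zero => simp
  | succ x ih =>
    have : gapOrd n (x + 1, 0 + 1) = true := by simp [gapOrd]; omega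
    rw [basicBlock_succ_succ, if_pos this, zero_add, ih (by omega)]
    simp [List.replicate_succ']

theorem gapOrd_row_one_ge (n k : ℕ) : basicBlock (gapOrd (n + 1)) (n + 1 + k, 1) =
    false :: true :: List.replicate (n + k) false := by
  induction k with
  | zero =>
    have : ¬ gapOrd (n + 1) (n + 1, 0 + 1) = true := by simp [gapOrd]
    rw [add_zero, basicBlock_succ_succ, if_neg this, zero_add, gapOrd_row_one_lt (by omega)]
    simp
  | succ k ih =>
    have : gapOrd (n + 1) (n + 1 + k + 1, 0 + 1) = true := by simp [gapOrd]; omega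
    rw [← add_assoc, basicBlock_succ_succ, if_pos this, zero_add, ih]
    simp [← add_assoc, List.replicate_succ']

theorem gapOrd_row_two (n x : ℕ) : basicBlock (gapOrd n) (x + 1, 2) =
    basicBlock (gapOrd n) (x + 1, 1) ++ basicBlock (gapOrd n) (x, 2) := by
  rw [basicBlock_succ_succ, if_neg (by simp [gapOrd])]

theorem gapOrd_row_ge_three (n x y : ℕ) : basicBlock (gapOrd n) (x + 1, y + 3) =
    basicBlock (gapOrd n) (x, y + 3) ++ basicBlock (gapOrd n) (x + 1, y + 2) := by
  rw [basicBlock_succ_succ, if_pos (by simp [gapOrd])]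

theorem gapOrd_row_two_last (n x : ℕ) : [true] <:+ basicBlock (gapOrd n) (x, 2) := by
  induction x with
  | zero => simp
  | succ x ih => rw [gapOrd_row_two]; exact ih.trans (List.suffix_append _ _)

theorem gapOrd_last (n x y : ℕ) : [true] <:+ basicBlock (gapOrd n) (x, y + 2) := by
  induction y generalizing x with
  | zero => exact gapOrd_row_two_last n x
  | succ y ih => cases x with
    | zero => simp
    | succ x => rw [gapOrd_row_ge_three]; exact (ih _).trans (List.suffix_append _ _)

theorem gapOrd_head (n x y : ℕ) : [true] <+: basicBlock (gapOrd n) (x, y + 3) := by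
  induction x with
  | zero => simp
  | succ x ih => rw [gapOrd_row_ge_three]; exact ih.trans (List.prefix_append _ _)

theorem gapOrd_row_two_head_lt {n x : ℕ} (hx : x < n) :
    [true] <+: basicBlock (gapOrd n) (x, 2) := by
  cases x with
  | zero => simp
  | succ x => rw [gapOrd_row_two, gapOrd_row_one_lt hx]; simp

theorem gapOrd_row_two_head_ge (n k : ℕ) :
    [false, true] <+: basicBlock (gapOrd (n + 1)) (n + 1 + k, 2) := by
  rw [add_right_comm, gapOrd_row_two, add_right_comm, gapOrd_row_one_ge]
  simp

theorem gapOrd_row_one_not_infix {n : ℕ} (hn : n ≠ 0) (x : ℕ) :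
    ¬ gapWord n <:+: basicBlock (gapOrd n) (x, 1) := by
  intro h
  have hc := h.count_le true
  obtain ⟨n, rfl⟩ := Nat.exists_eq_succ_of_ne_zero hn
  rcases lt_or_ge x (n + 1) with hx | hx
  · rw [gapOrd_row_one_lt hx] at hc
    simp [gapWord, List.count_replicate] at hc
  · obtain ⟨k, rfl⟩ := Nat.exists_eq_add_of_le hx
    rw [gapOrd_row_one_ge] at hc
    simp [gapWord, List.count_replicate] at hc

theorem gapOrd_row_two_not_infix {n : ℕ} (hn : n ≠ 0) (x : ℕ) :
    ¬ gapWord n <:+: basicBlock (gapOrd n) (x, 2) := by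
  obtain ⟨n, rfl⟩ := Nat.exists_eq_succ_of_ne_zero hn
  induction x with
  | zero => intro h; simpa [gapWord] using h.length_le
  | succ x ih =>
    have h₁ := gapOrd_row_one_not_infix hn (x + 1)
    rw [gapOrd_row_two]
    rcases lt_trichotomy x n with hx | rfl | hx
    · refine not_gapWord_infix_append (i := 0) (j := x + 1) h₁ ih ?_ ?_ (by omega)
      · rw [gapOrd_row_one_lt (by omega)]
      · simpa using gapOrd_row_two_head_lt (by omega)
    · refine not_gapWord_infix_append (i := 0) (j := x) h₁ ih ?_ ?_ (by omega)
      · have := gapOrd_row_one_ge x 0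
        simp only [add_zero] at this
        rw [this]
        exact List.suffix_cons _ _
      · simpa using gapOrd_row_two_head_lt (by omega)
    · obtain ⟨k, rfl⟩ := Nat.exists_eq_add_of_lt hx
      refine not_gapWord_infix_append (i := 1) (j := n + (k + 1)) h₁ ih ?_ ?_ (by omega)
      · have := gapOrd_row_one_ge n (k + 1)
        rw [show n + k + 1 + 1 = n + 1 + (k + 1) by omega, this]
        exact List.suffix_cons _ _
      · rw [add_right_comm]
        exact gapOrd_row_two_head_ge n k

theorem avoidable_gapWord {n : ℕ} (hn : 2 ≤ n) : Avoidable (gapWord n) := by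
  refine ⟨gapOrd n, fun x y => ?_⟩
  induction x, y using basicBlock_vertex_induction with
  | h00 => simp [gapWord]
  | hx x => intro h; simpa [gapWord] using h.length_le
  | hy y => intro h; simpa [gapWord] using h.length_le
  | hxy x y h₁ h₂ =>
    rcases y with _ | _ | y
    · exact gapOrd_row_one_not_infix (by omega) _
    · exact gapOrd_row_two_not_infix (by omega) _
    rw [gapOrd_row_ge_three]
    have hl := gapOrd_last n x (y + 1)
    have zero_lead (h : [true] <+: basicBlock (gapOrd n) (x + 1, y + 2)) :=
      not_gapWord_infix_append (i := 0) (j := 0) h₁ h₂ hl h (by omega)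
    cases y with
    | succ y => exact zero_lead (gapOrd_head n (x + 1) y)
    | zero =>
      rcases lt_or_ge (x + 1) n with hx | hx
      · exact zero_lead (gapOrd_row_two_head_lt hx)
      · obtain ⟨n, rfl⟩ := Nat.exists_eq_succ_of_ne_zero (by omega : n ≠ 0)
        obtain ⟨k, hk⟩ := Nat.exists_eq_add_of_le hx
        refine not_gapWord_infix_append (i := 1) (j := 0) h₁ h₂ hl ?_ (by omega)
        rw [hk]
        exact gapOrd_row_two_head_ge n k

/-! ### Words `aᴸ b aᴸ` occur for every ordering -/

/-- The word `aᵖ b aᵠ`. -/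
def spikeWord (p q : ℕ) : List Bool :=
  List.replicate p false ++ true :: List.replicate q false

theorem spikeWord_infix {L p q p' q' : ℕ} {P Q : List Bool} (hp : L ≤ p' + p) (hq : L ≤ q + q')
    (hP : List.replicate p' false <:+ P) (hQ : List.replicate q' false <+: Q) :
    spikeWord L L <:+: P ++ (spikeWord p q ++ Q) := by
  obtain ⟨A, rfl⟩ := hP
  obtain ⟨C, rfl⟩ := hQ
  obtain ⟨a, ha⟩ := Nat.exists_eq_add_of_le' hp
  obtain ⟨c, hc⟩ := Nat.exists_eq_add_of_le hq
  have e₁ : List.replicate p' false ++ List.replicate p false =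
      List.replicate a false ++ List.replicate L false := by
    rw [List.replicate_append_replicate, List.replicate_append_replicate, ha]
  have e₂ : List.replicate q false ++ List.replicate q' false =
      List.replicate L false ++ List.replicate c false := by
    rw [List.replicate_append_replicate, List.replicate_append_replicate, hc]
  refine ⟨A ++ List.replicate a false, List.replicate c false ++ C, ?_⟩
  calc _ = A ++ (List.replicate a false ++ List.replicate L false) ++ true ::
        ((List.replicate L false ++ List.replicate c false) ++ C) := by
          simp only [spikeWord, List.append_assoc, List.cons_append]
    _ = _ := by rw [← e₁, ← e₂]; simp only [spikeWord, List.append_assoc, List.cons_append]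

theorem spikeWord_infix_self {L p q : ℕ} (hp : L ≤ p) (hq : L ≤ q) :
    spikeWord L L <:+: spikeWord p q := by
  simpa using spikeWord_infix (p' := 0) (q' := 0) (P := []) (Q := []) (by simpa using hp)
    (by simpa using hq) (by simp) (by simp)

theorem spikeWord_infix_append_left {L p q p' q' : ℕ} (hp : L ≤ p) (hq : L ≤ q + p') :
    spikeWord L L <:+: spikeWord p q ++ spikeWord p' q' := by
  simpa [spikeWord] using spikeWord_infix (p' := 0) (P := []) (by simpa using hp) hq (by simp)
    (List.prefix_append (List.replicate p' false) (true :: List.replicate q' false))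

theorem spikeWord_infix_append_right {L p q p' q' : ℕ} (hp : L ≤ q + p') (hq : L ≤ q') :
    spikeWord L L <:+: spikeWord p q ++ spikeWord p' q' := by
  have h : List.replicate q false <:+ spikeWord p q :=
    ⟨List.replicate p false ++ [true], by simp [spikeWord]⟩
  simpa using spikeWord_infix (q' := 0) (Q := []) hp (by simpa using hq) h (by simp)

theorem exists_row_one_eq_spikeWord (ξ : ℕ × ℕ → Bool) : ∃ p q : ℕ → ℕ, Monotone p ∧ Monotone q ∧
    (∀ x, p x + q x = x) ∧ ∀ x, basicBlock ξ (x, 1) = spikeWord (p x) (q x) := by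
  refine ⟨Nat.count fun k => ¬ ξ (k + 1, 1) = true, Nat.count fun k => ξ (k + 1, 1) = true,
    Nat.count_monotone _, Nat.count_monotone _, fun x => ?_, fun x => ?_⟩
  · induction x with
    | zero => simp
    | succ x ih =>
      simp only [Nat.count_succ]
      split_ifs <;> omega
  · induction x with
    | zero => simp [spikeWord]
    | succ x ih =>
      rw [basicBlock_succ_succ, zero_add, ih, basicBlock_succ_zero]
      simp only [Nat.count_succ]
      cases h : ξ (x + 1, 1)
      · simp [spikeWord, List.replicate_succ]
      · simp [spikeWord, List.replicate_succ']

/-- Among the blocks of the first row, two with large indices stand next to each other in a block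
of the second row, because two of three consecutive blocks are appended on the same side. -/
theorem exists_adjacent_row_one (ξ : ℕ × ℕ → Bool) (N : ℕ) : ∃ x x' z, N ≤ x ∧ x ≤ x' ∧
    (basicBlock ξ (x, 1) ++ basicBlock ξ (x', 1) <:+: basicBlock ξ (z, 2) ∨
      basicBlock ξ (x', 1) ++ basicBlock ξ (x, 1) <:+: basicBlock ξ (z, 2)) := by
  have h₁ := basicBlock_succ_succ ξ N 1
  have h₂ := basicBlock_succ_succ ξ (N + 1) 1
  have h₃ := basicBlock_succ_succ ξ (N + 1 + 1) 1
  simp only [Nat.reduceAdd] at h₁ h₂ h₃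
  generalize basicBlock ξ (N, 2) = B at *
  by_cases c₁ : ξ (N + 1, 2) = true <;> by_cases c₂ : ξ (N + 1 + 1, 2) = true
  · refine ⟨N + 1, N + 1 + 1, N + 1 + 1, by omega, by omega, .inl ?_⟩
    rw [h₂, if_pos c₂, h₁, if_pos c₁]
    exact ⟨B, [], by simp⟩
  · by_cases c₃ : ξ (N + 1 + 1 + 1, 2) = true
    · refine ⟨N + 1, N + 1 + 1 + 1, N + 1 + 1 + 1, by omega, by omega, .inl ?_⟩
      rw [h₃, if_pos c₃, h₂, if_neg c₂, h₁, if_pos c₁]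
      exact ⟨basicBlock ξ (N + 1 + 1, 1) ++ B, [], by simp⟩
    · refine ⟨N + 1 + 1, N + 1 + 1 + 1, N + 1 + 1 + 1, by omega, by omega, .inr ?_⟩
      rw [h₃, if_neg c₃, h₂, if_neg c₂]
      exact ⟨[], basicBlock ξ (N + 1, 2), by simp⟩
  · by_cases c₃ : ξ (N + 1 + 1 + 1, 2) = true
    · refine ⟨N + 1 + 1, N + 1 + 1 + 1, N + 1 + 1 + 1, by omega, by omega, .inl ?_⟩
      rw [h₃, if_pos c₃, h₂, if_pos c₂]
      exact ⟨basicBlock ξ (N + 1, 2), [], by simp⟩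
    · refine ⟨N + 1, N + 1 + 1 + 1, N + 1 + 1 + 1, by omega, by omega, .inr ?_⟩
      rw [h₃, if_neg c₃, h₂, if_pos c₂, h₁, if_neg c₁]
      exact ⟨[], B ++ basicBlock ξ (N + 1 + 1, 1), by simp⟩
  · refine ⟨N + 1, N + 1 + 1, N + 1 + 1, by omega, by omega, .inr ?_⟩
    rw [h₂, if_neg c₂, h₁, if_neg c₁]
    exact ⟨[], B, by simp⟩

theorem not_avoidable_spikeWord (L : ℕ) : ¬ Avoidable (spikeWord L L) := by
  rintro ⟨ξ, h⟩
  obtain ⟨p, q, hp, hq, hpq, hB⟩ := exists_row_one_eq_spikeWord ξ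
  obtain ⟨x, x', z, hx, hxx', hz⟩ := exists_adjacent_row_one ξ (2 * L)
  have h₁ := hp hxx'
  have h₂ := hq hxx'
  have h₃ := hpq x
  have h₄ := hpq x'
  have hrow := h x' 1
  rw [hB] at hrow
  rw [hB, hB] at hz
  by_cases hpL : L ≤ p x'
  · by_cases hqL : L ≤ q x'
    · exact hrow (spikeWord_infix_self hpL hqL)
    · rcases hz with hz | hz <;>
        exact h z 2 ((spikeWord_infix_append_left (by omega) (by omega)).trans hz)
  · rcases hz with hz | hz <;>
      exact h z 2 ((spikeWord_infix_append_right (by omega) (by omega)).trans hz)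

theorem Avoidable.mono {w w' : List Bool} (h : Avoidable w) (hw : w <:+: w') : Avoidable w' := by
  obtain ⟨ξ, h⟩ := h
  exact ⟨ξ, fun x y hxy => h x y (hw.trans hxy)⟩

/-! ### Windows of a bi-infinite sequence -/

/-- The word `ω_s ⋯ ω_{s+l-1}`. -/
def window (ω : ℤ → Bool) (s : ℤ) (l : ℕ) : List Bool :=
  (List.range l).map fun u : ℕ => ω (s + u)

theorem window_add (ω : ℤ → Bool) (s : ℤ) (m n : ℕ) :
    window ω s (m + n) = window ω s m ++ window ω (s + m) n := by
  simp [window, List.range_add, Function.comp_def, add_assoc]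

theorem window_infix {ω : ℤ → Bool} {s s' : ℤ} {l l' : ℕ} (hs : s' ≤ s)
    (hl : s + l ≤ s' + l') : window ω s l <:+: window ω s' l' := by
  obtain ⟨m, rfl⟩ := Int.le.dest hs
  obtain ⟨n, rfl⟩ : ∃ n, l' = m + l + n := Nat.exists_eq_add_of_le (by omega)
  rw [window_add, window_add]
  exact List.infix_append _ _ _

theorem window_eq_replicate {ω : ℤ → Bool} {s : ℤ} {l : ℕ} {v : Bool}
    (h : ∀ t, s ≤ t → t < s + l → ω t = v) : window ω s l = List.replicate l v := by
  rw [List.eq_replicate_iff]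
  refine ⟨by simp [window], fun b hb => ?_⟩
  simp only [window, List.mem_map, List.mem_range] at hb
  obtain ⟨u, hu, rfl⟩ := hb
  exact h _ (by omega) (by omega)

theorem mem_SigmaXi_iff (ξ : ℕ × ℕ → Bool) (ω : ℤ → Bool) :
    ω ∈ SigmaXi ξ ↔ ∀ s l, ∃ p, window ω s l <:+: basicBlock ξ p := by
  have h (s : ℤ) (l : ℕ) :
      ((List.range l).map fun u => ω (s + u)) = window ω s l := by
    simp [window, Function.comp_def, ← List.map_eq_flatMap]
  simp only [SigmaXi, Set.mem_ofPred_eq, h]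

theorem forall_mem_SigmaXi_iff (ω : ℤ → Bool) :
    (∀ ξ, ω ∈ SigmaXi ξ) ↔ ∀ s l, ¬ Avoidable (window ω s l) := by
  simp only [mem_SigmaXi_iff]
  constructor
  · rintro h s l ⟨ξ, hξ⟩
    obtain ⟨⟨x, y⟩, hp⟩ := h ξ s l
    exact hξ x y hp
  · intro h ξ s l
    by_contra hne
    exact h s l ⟨ξ, fun x y hxy => hne ⟨(x, y), hxy⟩⟩

/-! ### The sequences in the small subshift -/

theorem not_avoidable_window_of_single {ω : ℤ → Bool} {v : Bool} {c : ℤ}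
    (h : ∀ t, t ≠ c → ω t = v) (hc : ω c = !v) (s : ℤ) (l : ℕ) :
    ¬ Avoidable (window ω s l) := by
  set L := (c - s).natAbs + l with hL
  have key : window ω (c - L) (L + 1 + L) =
      List.replicate L v ++ (!v) :: List.replicate L v := by
    rw [window_add, window_add, window_eq_replicate (v := v), window_eq_replicate (v := !v),
      window_eq_replicate (v := v)]
    · simp
    · exact fun t ht _ => h t (by push_cast at ht; omega)
    · intro t ht ht'
      rw [show t = c by push_cast at ht'; omega, hc]
    · exact fun t _ ht => h t (by omega)
  intro hav
  have hav := hav.mono (window_infix (s' := c - L) (l' := L + 1 + L) (by omega)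
    (by push_cast; omega))
  rw [key] at hav
  cases v with
  | false => exact not_avoidable_spikeWord L hav
  | true => exact not_avoidable_spikeWord L (by simpa [spikeWord] using hav.map_not)

theorem not_avoidable_window_of_const {ω : ℤ → Bool} {v : Bool} (h : ∀ t, ω t = v) (s : ℤ)
    (l : ℕ) : ¬ Avoidable (window ω s l) := by
  have e : window ω s l = window (Function.update ω (s - 1) (!v)) s l := by
    refine List.map_congr_left fun u _ => ?_
    rw [Function.update_of_ne (by omega)]
  rw [e]
  refine not_avoidable_window_of_single (v := v) (c := s - 1) (fun t ht => ?_) (by simp) s l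
  rw [Function.update_of_ne ht, h]

theorem avoidable_step (v : Bool) : Avoidable [v, v, !v, !v] := by
  cases v
  · exact avoidable_ttff.map_not
  · exact avoidable_ttff

theorem avoidable_alternating (v : Bool) : Avoidable [v, !v, v, !v] := by
  cases v
  · exact avoidable_ftft
  · exact avoidable_ftft.map_not

theorem avoidable_gap (v : Bool) {n : ℕ} (hn : 2 ≤ n) :
    Avoidable (v :: (List.replicate n (!v) ++ [v])) := by
  cases v
  · simpa [gapWord] using (avoidable_gapWord hn).map_not
  · exact avoidable_gapWord hn

theorem not_step {ω : ℤ → Bool} (hω : ∀ s l, ¬ Avoidable (window ω s l))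
    {s : ℤ} {v : Bool} (h₀ : ω s = v) (h₁ : ω (s + 1) = v)
    (h₂ : ω (s + 2) = !v) : ω (s + 3) = v := by
  by_contra h₃
  apply hω s 4
  have h₃ : ω (s + 3) = !v := Bool.eq_not.2 h₃
  simpa [window, List.range_succ, h₀, h₁, h₂, h₃] using avoidable_step v

theorem not_alternating {ω : ℤ → Bool} (hω : ∀ s l, ¬ Avoidable (window ω s l))
    {s : ℤ} {v : Bool} (h₀ : ω s = v) (h₁ : ω (s + 1) = !v)
    (h₂ : ω (s + 2) = v) : ω (s + 3) = v := by
  by_contra h₃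
  apply hω s 4
  have h₃ : ω (s + 3) = !v := Bool.eq_not.2 h₃
  simpa [window, List.range_succ, h₀, h₁, h₂, h₃] using avoidable_alternating v

theorem gap_le_one {ω : ℤ → Bool} (hω : ∀ s l, ¬ Avoidable (window ω s l))
    {s : ℤ} {n : ℕ} {v : Bool} (h₀ : ω s = v)
    (h : ∀ t, s < t → t < s + 1 + n → ω t = !v) (h₁ : ω (s + 1 + n) = v) : n < 2 := by
  by_contra! hn
  apply hω s (1 + n + 1)
  have e : window ω s (1 + n + 1) = v :: (List.replicate n (!v) ++ [v]) := by
    rw [window_add, window_add, window_eq_replicate (v := v), window_eq_replicate (v := !v),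
      window_eq_replicate (v := v)]
    · simp
    · intro t ht ht'
      rw [show t = s + 1 + n by push_cast at *; omega, h₁]
    · exact fun t ht ht' => h t (by push_cast at ht; omega) (by push_cast at ht'; omega)
    · intro t ht ht'
      rw [show t = s by push_cast at ht'; omega, h₀]
  rw [e]
  exact avoidable_gap v hn

/-- An isolated letter is the only occurrence of that letter. -/
theorem eq_of_isolated {ω : ℤ → Bool} (hω : ∀ s l, ¬ Avoidable (window ω s l))
    {c : ℤ} {v : Bool} (hl : ω (c - 1) = v) (hc : ω c = !v)
    (hr : ω (c + 1) = v) (t : ℤ) (ht : t ≠ c) : ω t = v := by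
  have hr₂ : ω (c + 2) = v := by
    have := not_alternating hω (s := c - 1) hl (by simpa using hc)
      (by rw [← hr]; congr 1; ring)
    rw [← this]; congr 1; ring
  have hl₂ : ω (c - 2) = v := by
    by_contra h
    have h : ω (c - 2) = !v := Bool.eq_not.2 h
    have := not_alternating hω (s := c - 2) h (by rw [Bool.not_not, ← hl]; congr 1; ring)
      (by rw [← hc]; congr 1; ring)
    rw [show c - 2 + 3 = c + 1 by ring, hr] at this
    simp at this
  have right : ∀ n : ℕ, ω (c + 1 + n) = v := by
    intro n
    induction n using Nat.strong_induction_on with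
    | _ n ih =>
      rcases n with _ | _ | n
      · simpa using hr
      · rw [← hr₂]; congr 1; push_cast; ring
      · by_contra h
        have := gap_le_one hω (s := c) (n := n + 2) hc (fun t ht ht' => ?_)
          (Bool.eq_not.2 h)
        · omega
        · rw [Bool.not_not, ← ih (t - c - 1).toNat (by push_cast at ht'; omega)]
          congr 1
          omega
  have left : ∀ n : ℕ, ω (c - 1 - n) = v := by
    intro n
    induction n using Nat.strong_induction_on with
    | _ n ih =>
      rcases n with _ | _ | n
      · simpa using hl
      · rw [← hl₂]; congr 1; push_cast; ring
      · by_contra h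
        have := gap_le_one hω (s := c - 1 - (n + 2 : ℕ)) (n := n + 2) (v := !v)
          (Bool.eq_not.2 h) (fun t ht ht' => ?_)
          (by rw [← hc]; congr 1; ring)
        · omega
        · rw [Bool.not_not, ← ih (c - 1 - t).toNat (by push_cast at ht ht' ⊢; omega)]
          congr 1
          push_cast at ht'
          omega
  rcases lt_or_gt_of_ne ht with h | h
  · rw [← left (c - 1 - t).toNat]; congr 1; omega
  · rw [← right (t - c - 1).toNat]; congr 1; omega

theorem exists_isolated_of_ne {ω : ℤ → Bool} (hω : ∀ s l, ¬ Avoidable (window ω s l))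
    {s : ℤ} (hs : ω (s + 1) ≠ ω s) :
    ∃ v c, ω (c - 1) = v ∧ ω c = !v ∧ ω (c + 1) = v := by
  have h₁ : ω (s + 1) = !ω s := by
    revert hs; cases ω (s + 1) <;> cases ω s <;> simp
  by_cases h₂ : ω (s + 2) = ω s
  · exact ⟨ω s, s + 1, by simp, h₁, by rw [← h₂]; congr 1; ring⟩
  by_cases h₃ : ω (s - 1) = ω s
  · have := not_step hω (s := s - 1) h₃ (by simp) (by rw [← h₁]; congr 1; ring)
    exact absurd (by rw [← this]; congr 1; ring) h₂
  · exact ⟨!ω s, s, Bool.eq_not.2 h₃, by simp, h₁⟩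

theorem stmt18 (ω : ℤ → Bool) :
    (∀ ξ : ℕ × ℕ → Bool, ω ∈ SigmaXi ξ) ↔
      ((∀ t, ω t = false) ∨ (∀ t, ω t = true) ∨
       (∃ c : ℤ, ∀ t, ω t = true ↔ t = c) ∨ (∃ c : ℤ, ∀ t, ω t = false ↔ t = c)) := by
  rw [forall_mem_SigmaXi_iff]
  constructor
  · intro hω
    by_cases hconst : ∀ s, ω (s + 1) = ω s
    · have h : ∀ t, ω t = ω 0 := fun t => by
        induction t using Int.induction_on with
        | zero => rfl
        | succ i ih => rw [hconst, ih]
        | pred i ih => rw [← ih, ← hconst (-i - 1)]; simp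
      cases h₀ : ω 0 <;> simp only [h₀] at h
      · exact .inl h
      · exact .inr (.inl h)
    · push Not at hconst
      obtain ⟨s, hs⟩ := hconst
      obtain ⟨v, c, hl, hc, hr⟩ := exists_isolated_of_ne hω hs
      have h := eq_of_isolated hω hl hc hr
      refine .inr (.inr ?_)
      cases v
      · refine .inl ⟨c, fun t => ⟨fun ht => ?_, fun ht => by simpa [ht] using hc⟩⟩
        by_contra hne
        simp [h t hne] at ht
      · refine .inr ⟨c, fun t => ⟨fun ht => ?_, fun ht => by simpa [ht] using hc⟩⟩
        by_contra hne
        simp [h t hne] at ht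
  · rintro (h | h | ⟨c, h⟩ | ⟨c, h⟩)
    · exact not_avoidable_window_of_const h
    · exact not_avoidable_window_of_const h
    · exact not_avoidable_window_of_single (v := false) (c := c)
        (fun t ht => by simpa using mt (h t).1 ht) ((h c).2 rfl)
    · exact not_avoidable_window_of_single (v := true) (c := c)
        (fun t ht => by simpa using mt (h t).1 ht) ((h c).2 rfl)
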